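/- arXiv:2411.08151 — 2 statements merged into one kernel-verified Lean document; each statement's English description precedes it below -/
import Mathlib

section
/- There exist universal constants c₀, c₁, c₂, c₃ > 0 such that the following holds. Let G be an n-vertex directed unweighted graph, P a set of p demand pairs, and π(·,·) a consistent tiebreaking scheme for (G,P) such that every edge of G lies on some path of π(P) and, with ℓ̂ = (Σ_{π ∈ π(P)} |π|)/p, every path π ∈ π(P) satisfies ℓ̂/2 ≤ |π| ≤ 2ℓ̂. Let d = ⌈|E(G)|/n⌉ and suppose d ≥ max(c₀, 10p/n^{1/2}). Then there exists a set S ⊆ V(G) with c₁·d ≤ |S| ≤ c₂·d, such that deg_G(v) ≥ c₁·d for every v ∈ S, and dist_G(u,v) ≤ c₃·ℓ̂·p²/(n·d²) for all u,v ∈ S. -/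
open Finset

/-- A walk in a directed edge set `F`, given as the list of visited vertices. -/
def IsWalkOn {V : Type} (F : Finset (V × V)) (s t : V) (l : List V) : Prop :=
  l.Chain' (fun a b => (a, b) ∈ F) ∧ l.head? = some s ∧ l.getLast? = some t

def ReachableOn {V : Type} (F : Finset (V × V)) (s t : V) : Prop :=
  ∃ l, IsWalkOn F s t l

/-- A directed weighted graph: a finite set of directed edges together with weights. -/
structure WDigraph (V : Type) where
  Edge : Finset (V × V)
  w : V × V → ℝ

namespace WDigraph

variable {V : Type}

/-- Total weight of a walk (sum of weights of consecutive pairs). -/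
def walkWeight (G : WDigraph V) (l : List V) : ℝ :=
  ((l.zip l.tail).map G.w).sum

/-- Distance from `s` to `t` using only edges of `F`, with weights of `G`. -/
noncomputable def distOn (G : WDigraph V) (F : Finset (V × V)) (s t : V) : ℝ :=
  sInf {x | ∃ l, IsWalkOn F s t l ∧ G.walkWeight l = x}

def IsWalk (G : WDigraph V) (s t : V) (l : List V) : Prop :=
  IsWalkOn G.Edge s t l

def Reachable (G : WDigraph V) (s t : V) : Prop :=
  ReachableOn G.Edge s t

noncomputable def dist (G : WDigraph V) (s t : V) : ℝ :=
  G.distOn G.Edge s t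

/-- All edge weights equal to `1`. -/
def Unweighted (G : WDigraph V) : Prop := ∀ e ∈ G.Edge, G.w e = 1

/-- All edge weights positive. -/
def PosWeights (G : WDigraph V) : Prop := ∀ e ∈ G.Edge, 0 < G.w e

/-- `F` is (the edge set of) an exact distance preserver of `(G, P)`. -/
def IsExactPreserver (G : WDigraph V) (F : Finset (V × V)) (P : Finset (V × V)) : Prop :=
  F ⊆ G.Edge ∧ ∀ q ∈ P, ReachableOn F q.1 q.2 ∧ G.distOn F q.1 q.2 = G.dist q.1 q.2

/-- Total (in plus out) degree of a vertex. -/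
def degree [DecidableEq V] (G : WDigraph V) (v : V) : ℕ :=
  (G.Edge.filter fun e => e.1 = v ∨ e.2 = v).card

end WDigraph
/-- The list of (directed) edges of a path given by its vertex list. -/
def pathEdges {V : Type} (l : List V) : List (V × V) := l.zip l.tail

/-- A tiebreaking scheme: a fixed shortest path (a simple walk achieving the distance)
for each demand pair of `P`. -/
structure TBScheme {V : Type} (G : WDigraph V) (P : Finset (V × V)) where
  path : V × V → List V
  walk : ∀ q ∈ P, G.IsWalk q.1 q.2 (path q)
  nodup : ∀ q ∈ P, (path q).Nodup
  shortest : ∀ q ∈ P, G.walkWeight (path q) = G.dist q.1 q.2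

/-- `x` strictly precedes `y` on the list `l`. -/
def Precedes {V : Type} (l : List V) (x y : V) : Prop :=
  ∃ i j : Fin l.length, i < j ∧ l.get i = x ∧ l.get j = y

/-- The segment of `l` from (the first occurrence of) `x` to (the last occurrence of) `y`. -/
def seg {V : Type} [DecidableEq V] (l : List V) (x y : V) : List V :=
  ((l.dropWhile fun a => decide (a ≠ x)).reverse.dropWhile fun a => decide (a ≠ y)).reverse

/-- Consistency: whenever `x` precedes `y` on two paths of the scheme,
the corresponding subpaths from `x` to `y` coincide. -/
def TBScheme.Consistent {V : Type} [DecidableEq V] {G : WDigraph V} {P : Finset (V × V)}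
    (S : TBScheme G P) : Prop :=
  ∀ q₁ ∈ P, ∀ q₂ ∈ P, ∀ x y : V,
    Precedes (S.path q₁) x y → Precedes (S.path q₂) x y →
      seg (S.path q₁) x y = seg (S.path q₂) x y

/-- The paths of the scheme are pairwise edge-disjoint. -/
def TBScheme.EdgeDisjoint {V : Type} {G : WDigraph V} {P : Finset (V × V)}
    (S : TBScheme G P) : Prop :=
  ∀ q₁ ∈ P, ∀ q₂ ∈ P, S.path q₁ ≠ S.path q₂ →
    ∀ e ∈ pathEdges (S.path q₁), e ∉ pathEdges (S.path q₂)

/-- Ceiling division of naturals: `⌈a / b⌉`. -/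
def natCeilDiv (a b : ℕ) : ℕ := (a + b - 1) / b

theorem mem_pathEdges_iff {V : Type} {l : List V} {u y : V} :
    (u, y) ∈ pathEdges l ↔ ∃ i, ∃ h : i + 1 < l.length, l[i] = u ∧ l[i + 1] = y := by
  unfold pathEdges
  rw [List.mem_iff_getElem]
  constructor
  · rintro ⟨i, hi, h⟩
    simp only [List.length_zip, List.length_tail] at hi
    simp only [List.getElem_zip, List.getElem_tail, Prod.mk.injEq] at h
    exact ⟨i, by omega, h⟩
  · rintro ⟨i, hi, h⟩
    refine ⟨i, ?_, ?_⟩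
    · simp only [List.length_zip, List.length_tail]
      omega
    · simp only [List.getElem_zip, List.getElem_tail, Prod.mk.injEq]
      exact h

theorem mem_of_mem_pathEdges {V : Type} {l : List V} {e : V × V} (h : e ∈ pathEdges l) :
    e.2 ∈ l := by
  obtain ⟨i, hi, -, h⟩ := mem_pathEdges_iff.1 (show (e.1, e.2) ∈ pathEdges l from h)
  exact h ▸ List.getElem_mem hi

theorem eq_of_mem_pathEdges {V : Type} {l : List V} (hl : l.Nodup) {e f : V × V}
    (he : e ∈ pathEdges l) (hf : f ∈ pathEdges l) (h : e.2 = f.2) : e = f := by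
  obtain ⟨i, hi, h1, h2⟩ := mem_pathEdges_iff.1 (show (e.1, e.2) ∈ pathEdges l from he)
  obtain ⟨j, hj, h3, h4⟩ := mem_pathEdges_iff.1 (show (f.1, f.2) ∈ pathEdges l from hf)
  have hij : i + 1 = j + 1 := (hl.getElem_inj_iff).1 (h2.trans (h.trans h4.symm))
  obtain rfl : i = j := by omega
  exact Prod.ext (h1.symm.trans h3) h

theorem precedes_of_idxOf_lt {V : Type} [DecidableEq V] {l : List V} {x y : V} (hy : y ∈ l)
    (h : l.idxOf x < l.idxOf y) : Precedes l x y := by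
  have hy' := List.idxOf_lt_length_iff.2 hy
  exact ⟨⟨l.idxOf x, h.trans hy'⟩, ⟨l.idxOf y, hy'⟩, h, by simp, by simp⟩

/-- On a simple path, the last edge of the segment from `x` to `y` is the edge entering `y`. -/
theorem getLast?_dropLast_seg {V : Type} [DecidableEq V] {l : List V} (hl : l.Nodup) {x u y : V}
    (he : (u, y) ∈ pathEdges l) (h : Precedes l x y) :
    (seg l x y).dropLast.getLast? = some u := by
  obtain ⟨i, hi, h1, h2⟩ := mem_pathEdges_iff.1 he
  obtain ⟨a, b, hab, ha, hb⟩ := h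
  have hbi : (b : ℕ) = i + 1 := (hl.getElem_inj_iff).1 (by simpa using hb.trans h2.symm)
  have hxm : x ∈ l.take (i + 1) := by
    rw [List.mem_take_iff_getElem]
    exact ⟨a, by have : (a : ℕ) < b := hab; omega, by simpa using ha⟩
  obtain ⟨A, M, hAM⟩ := List.append_of_mem hxm
  have hlast : (l.take (i + 1)).getLast? = some u := by
    rw [List.getLast?_take]
    simp [List.getElem?_eq_getElem (show i < l.length by omega), h1]
  have hl' : l = A ++ x :: M ++ y :: l.drop (i + 2) := by
    rw [← hAM, ← h2, List.getElem_cons_drop, List.take_append_drop]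
  generalize l.drop (i + 2) = C at hl'
  subst hl'
  have hxA : ∀ z ∈ A, z ≠ x := by
    rintro z hz rfl
    simp only [List.append_assoc, List.nodup_append] at hl
    exact hl.2.2 z hz z (by simp) rfl
  have hyC : ∀ z ∈ C, z ≠ y := by
    rintro z hz rfl
    rw [List.nodup_append] at hl
    exact (List.nodup_cons.1 hl.2.1).1 hz
  have hseg : seg (A ++ x :: M ++ y :: C) x y = x :: M ++ [y] := by
    unfold seg
    rw [List.append_assoc, List.dropWhile_append_of_pos (by simpa using hxA)]
    rw [List.cons_append, List.dropWhile_cons_of_neg (by simp)]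
    rw [← List.cons_append, List.reverse_append, List.reverse_cons, List.append_assoc,
      List.dropWhile_append_of_pos (by simpa using hyC)]
    simp
  rw [hseg, List.dropLast_concat]
  rw [hAM] at hlast
  simpa using hlast

theorem TBScheme.Consistent.edge_eq {V : Type} [DecidableEq V] {G : WDigraph V}
    {P : Finset (V × V)} {S : TBScheme G P} (hS : S.Consistent) {q₁ q₂ : V × V} (h₁ : q₁ ∈ P)
    (h₂ : q₂ ∈ P) {e f : V × V} (he : e ∈ pathEdges (S.path q₁)) (hf : f ∈ pathEdges (S.path q₂))
    (hef : e.2 = f.2) {x : V} (hx₁ : (S.path q₁).idxOf x < (S.path q₁).idxOf e.2)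
    (hx₂ : (S.path q₂).idxOf x < (S.path q₂).idxOf e.2) : e = f := by
  have p₁ := precedes_of_idxOf_lt (mem_of_mem_pathEdges he) hx₁
  have p₂ := precedes_of_idxOf_lt (hef ▸ mem_of_mem_pathEdges hf) hx₂
  have s₁ := getLast?_dropLast_seg (S.nodup _ h₁) he p₁
  have s₂ := getLast?_dropLast_seg (u := f.1) (S.nodup _ h₂) (hef ▸ hf) p₂
  rw [hS _ h₁ _ h₂ _ _ p₁ p₂, s₂] at s₁
  exact Prod.ext (Option.some.inj s₁).symm hef

/-- There is a walk with exactly `k` edges from `u` to `v`. -/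
def WDigraph.HasWalk {V : Type} (G : WDigraph V) (k : ℕ) (u v : V) : Prop :=
  ∃ l, G.IsWalk u v l ∧ l.length = k + 1

namespace WDigraph

variable {V : Type} {G : WDigraph V}

theorem HasWalk.trans {a b : ℕ} {u v w : V} (h₁ : G.HasWalk a u v) (h₂ : G.HasWalk b v w) :
    G.HasWalk (a + b) u w := by
  obtain ⟨l, ⟨hc, hh, ht⟩, hl⟩ := h₁
  obtain ⟨m, ⟨hc', hh', ht'⟩, hm⟩ := h₂
  obtain _ | ⟨y, m⟩ := m
  · simp at hm
  obtain rfl : y = v := by simpa using hh'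
  refine ⟨l ++ m, ⟨?_, ?_, ?_⟩, ?_⟩
  · change List.IsChain _ _ at hc hc'
    change List.IsChain _ _
    rw [List.isChain_append]
    rw [List.isChain_cons] at hc'
    refine ⟨hc, hc'.2, ?_⟩
    intro x hx z hz
    rw [ht] at hx
    obtain rfl : y = x := by simpa using hx
    exact hc'.1 z hz
  · simp [hh]
  · rw [List.getLast?_append, ht]
    cases m with
    | nil => simpa using ht'
    | cons z m =>
      rw [List.getLast?_cons_cons] at ht'
      simp [ht']
  · simp only [List.length_append, List.length_cons] at *
    omega

theorem IsWalk.hasWalk_idxOf [DecidableEq V] {s t u v : V} {l : List V} (h : G.IsWalk s t l)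
    (hv : v ∈ l) (huv : l.idxOf u < l.idxOf v) : G.HasWalk (l.idxOf v - l.idxOf u) u v := by
  have hv' := List.idxOf_lt_length_iff.2 hv
  refine ⟨(l.take (l.idxOf v + 1)).drop (l.idxOf u), ⟨?_, ?_, ?_⟩, ?_⟩
  · exact (h.1.take _).drop _
  · rw [List.head?_drop, List.getElem?_take]
    simp [show l.idxOf u < l.idxOf v + 1 by omega,
      List.getElem?_eq_getElem (show l.idxOf u < l.length by omega)]
  · rw [List.getLast?_drop, List.getLast?_take]
    simp [List.getElem?_eq_getElem hv']
    omega
  · simp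
    omega

theorem Unweighted.walkWeight_eq (hG : G.Unweighted) {s t : V} {l : List V}
    (h : G.IsWalk s t l) : G.walkWeight l = (l.length - 1 : ℕ) := by
  have key : ∀ x ∈ (l.zip l.tail).map G.w, x = 1 := by
    intro x hx
    obtain ⟨e, he, rfl⟩ := List.mem_map.1 hx
    apply hG
    obtain ⟨i, hi, h1, h2⟩ := mem_pathEdges_iff.1 (show (e.1, e.2) ∈ pathEdges l from he)
    have := (List.isChain_iff_getElem.1 h.1) i hi
    rw [h1, h2] at this
    exact this
  unfold walkWeight
  rw [List.eq_replicate_of_mem key]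
  simp

theorem Unweighted.dist_le (hG : G.Unweighted) {k : ℕ} {u v : V} (h : G.HasWalk k u v) :
    G.Reachable u v ∧ G.dist u v ≤ k := by
  obtain ⟨l, hl, hk⟩ := h
  refine ⟨⟨l, hl⟩, csInf_le ⟨0, ?_⟩ ⟨l, hl, ?_⟩⟩
  · rintro x ⟨m, hm, rfl⟩
    rw [hG.walkWeight_eq hm]
    positivity
  · rw [hG.walkWeight_eq hl, hk]
    simp

end WDigraph

/-- An `L`-separated family of reals in `[-M, M]` has at most `⌊2 * M / L⌋ + 1` members. -/
theorem card_le_of_separated {α : Type*} (s : Finset α) (φ : α → ℝ) {M L : ℝ} (hL : 0 < L)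
    (hM : ∀ a ∈ s, |φ a| ≤ M) (hsep : ∀ a ∈ s, ∀ b ∈ s, a ≠ b → L < |φ a - φ b|) :
    s.card ≤ ⌊2 * M / L⌋₊ + 1 := by
  rw [← Finset.card_range (⌊2 * M / L⌋₊ + 1)]
  have hnn : ∀ a ∈ s, 0 ≤ (φ a + M) / L := fun a ha =>
    div_nonneg (by linarith [(abs_le.1 (hM a ha)).1]) hL.le
  refine Finset.card_le_card_of_injOn (fun a => ⌊(φ a + M) / L⌋₊) ?_ ?_
  · intro a ha
    simp only [Finset.coe_range, Set.mem_Iio, Nat.lt_succ_iff]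
    apply Nat.floor_le_floor
    gcongr
    linarith [(abs_le.1 (hM a ha)).2]
  · intro a ha b hb hab
    by_contra hne
    have h1 := Nat.floor_le (hnn a ha)
    have h2 := Nat.lt_floor_add_one ((φ a + M) / L)
    have h3 := Nat.floor_le (hnn b hb)
    have h4 := Nat.lt_floor_add_one ((φ b + M) / L)
    simp only at hab
    rw [hab] at h1 h2
    have h5 : |(φ a + M) / L - (φ b + M) / L| < 1 := by rw [abs_lt]; constructor <;> linarith
    rw [← sub_div, abs_div, abs_of_pos hL, div_lt_one hL] at h5
    have := hsep a ha b hb hne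
    rw [show φ a + M - (φ b + M) = φ a - φ b by ring] at h5
    linarith

/-- All but `t * |V|` edges point to vertices of in-degree more than `t`. -/
theorem card_le_card_heavy_add {V : Type} [DecidableEq V] [Fintype V] (E : Finset (V × V))
    (t : ℕ) :
    E.card ≤ (E.filter fun e => t < (E.filter fun f => f.2 = e.2).card).card
      + t * Fintype.card V := by
  rw [← Finset.card_filter_add_card_filter_not
    (s := E) (fun e => t < (E.filter fun f => f.2 = e.2).card)]
  gcongr
  refine Finset.card_le_mul_card_image_of_maps_to (f := Prod.snd) (t := Finset.univ)
    (by simp) t ?_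
  intro v _
  rw [Finset.filter_filter]
  by_cases hv : ∃ e ∈ E, ¬ t < (E.filter fun f => f.2 = e.2).card ∧ e.2 = v
  · obtain ⟨e, -, he, rfl⟩ := hv
    refine (Finset.card_le_card ?_).trans (not_lt.1 he)
    intro f hf
    rw [Finset.mem_filter] at hf ⊢
    exact ⟨hf.1, hf.2.2⟩
  · rw [Finset.card_eq_zero.2]
    · exact Nat.zero_le _
    · exact Finset.filter_eq_empty_iff.2 fun e he h => hv ⟨e, he, h⟩

/-- If every `a ∈ A` occurs at least `t` times as a first coordinate in `K`, and the bad pairs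
of `K` are few for each key, then some `a ∈ A` is the first coordinate of many good pairs. -/
theorem exists_lt_card_good {α κ : Type*} [DecidableEq α] [DecidableEq κ] (K : Finset (α × α))
    (good : α × α → Prop) [DecidablePred good] (A : Finset α) (Q : Finset κ) (key : α × α → κ)
    (t s N : ℕ) (hA : ∀ x ∈ K, x.1 ∈ A) (hQ : ∀ x ∈ K, key x ∈ Q)
    (ht : ∀ a ∈ A, t ≤ (K.filter fun x => x.1 = a).card)
    (hN : ∀ k ∈ Q, ((K.filter fun x => ¬ good x).filter fun x => key x = k).card ≤ N)
    (h : N * Q.card + A.card * s < A.card * t) :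
    ∃ a ∈ A, s < ((K.filter good).filter fun x => x.1 = a).card := by
  by_contra! hcon
  have h1 : A.card * t ≤ K.card := by
    rw [Finset.card_eq_sum_card_fiberwise (f := Prod.fst) (t := A) hA, ← smul_eq_mul,
      ← Finset.sum_const]
    exact Finset.sum_le_sum ht
  have h2 : (K.filter good).card ≤ s * A.card :=
    Finset.card_le_mul_card_image_of_maps_to (f := Prod.fst)
      (fun x hx => hA x (Finset.mem_filter.1 hx).1) s hcon
  have h3 : (K.filter fun x => ¬ good x).card ≤ N * Q.card :=
    Finset.card_le_mul_card_image_of_maps_to (f := key)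
      (fun x hx => hQ x (Finset.mem_filter.1 hx).1) N hN
  have h4 := Finset.card_filter_add_card_filter_not (s := K) good
  nlinarith

/-- If the bound on bad pairs of edges leaves enough good ones, some `s + 1` vertices of
in-degree more than `t` are within distance `L` of a common vertex in both directions. -/
theorem exists_cluster {V : Type} [DecidableEq V] {G : WDigraph V}
    (hG : G.Unweighted) {P : Finset (V × V)} {S : TBScheme G P} (hS : S.Consistent)
    (hcov : ∀ e ∈ G.Edge, ∃ q ∈ P, e ∈ pathEdges (S.path q)) {M L : ℝ} (hL : 0 < L)
    (hM : ∀ q ∈ P, ((S.path q).length : ℝ) - 1 ≤ M) (t s : ℕ)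
    (h : (⌊2 * M / L⌋₊ + 1) * P.card ^ 2
        + (G.Edge.filter fun e => t < (G.Edge.filter fun f => f.2 = e.2).card).card * s
      < (G.Edge.filter fun e => t < (G.Edge.filter fun f => f.2 = e.2).card).card * t) :
    ∃ T : Finset V, T.card = s + 1 ∧ (∀ v ∈ T, t < G.degree v) ∧
      ∀ u ∈ T, ∀ v ∈ T, G.Reachable u v ∧ G.dist u v ≤ 2 * L := by
  classical
  choose! r hrP hr using hcov
  set E := G.Edge
  set A := E.filter fun e => t < (E.filter fun f => f.2 = e.2).card with hAdef
  set K := (E ×ˢ E).filter fun x => x.1 ∈ A ∧ x.2.2 = x.1.2 ∧ x.2 ≠ x.1 with hKdef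
  let pos : V × V → V → ℕ := fun q v => (S.path q).idxOf v
  let φ : (V × V) × (V × V) → ℝ := fun x => pos (r x.1) x.1.2 - pos (r x.2) x.1.2
  let key : (V × V) × (V × V) → (V × V) × (V × V) := fun x => (r x.1, r x.2)
  let good : (V × V) × (V × V) → Prop := fun x => ∃ y ∈ K, key y = key x ∧
    pos (r x.1) x.1.2 < pos (r x.1) y.1.2 ∧ φ y - φ x ≤ L
  have hK : ∀ x ∈ K, x.1 ∈ E ∧ x.2 ∈ E ∧ x.1 ∈ A ∧ x.2.2 = x.1.2 ∧ x.2 ≠ x.1 := by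
    intro x hx
    simp only [hKdef, Finset.mem_filter, Finset.mem_product] at hx
    tauto
  have hmem : ∀ x ∈ K, x.1.2 ∈ S.path (r x.1) ∧ x.1.2 ∈ S.path (r x.2) := by
    intro x hx
    obtain ⟨h1, h2, -, h3, -⟩ := hK x hx
    exact ⟨mem_of_mem_pathEdges (hr _ h1), h3 ▸ mem_of_mem_pathEdges (hr _ h2)⟩
  -- two common vertices appear in opposite orders on the two paths
  have hrev : ∀ x ∈ K, ∀ y ∈ K, key y = key x → pos (r x.1) x.1.2 < pos (r x.1) y.1.2 →
      pos (r x.2) y.1.2 < pos (r x.2) x.1.2 := by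
    intro x hx y hy hkey hlt
    obtain ⟨k1, k2⟩ := Prod.ext_iff.1 hkey
    simp only [key] at k1 k2
    by_contra! hle
    obtain ⟨h1, h2, -, h3, h4⟩ := hK y hy
    rcases hle.lt_or_eq with hl | he
    · refine h4 (hS.edge_eq (hrP _ h1) (hrP _ h2) (hr _ h1) (hr _ h2) h3.symm (x := x.1.2)
        ?_ ?_).symm
      · rw [k1]
        exact hlt
      · rw [k2]
        exact hl
    · have : x.1.2 = y.1.2 := (List.idxOf_inj (hmem x hx).2).1 he
      rw [this] at hlt
      exact lt_irrefl _ hlt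
  obtain ⟨e, heA, he⟩ := exists_lt_card_good K good A (P ×ˢ P) key t s (⌊2 * M / L⌋₊ + 1)
    (fun x hx => (hK x hx).2.2.1)
    (fun x hx => Finset.mem_product.2 ⟨hrP _ (hK x hx).1, hrP _ (hK x hx).2.1⟩)
    (by
      intro a ha
      obtain ⟨haE, hat⟩ := Finset.mem_filter.1 ha
      have hsub : (((E.filter fun f => f.2 = a.2).erase a).image fun f => (a, f)) ⊆
          K.filter fun x => x.1 = a := by
        intro x hx
        obtain ⟨f, hf, rfl⟩ := Finset.mem_image.1 hx
        obtain ⟨hfa, hf⟩ := Finset.mem_erase.1 hf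
        obtain ⟨hfE, hf⟩ := Finset.mem_filter.1 hf
        simp only [hKdef, Finset.mem_filter, Finset.mem_product]
        exact ⟨⟨⟨haE, hfE⟩, ha, hf, hfa⟩, trivial⟩
      have hcard := Finset.card_le_card hsub
      have ha_mem : a ∈ E.filter fun f => f.2 = a.2 := Finset.mem_filter.2 ⟨haE, rfl⟩
      rw [Finset.card_image_of_injective _ (Prod.mk_right_injective a),
        Finset.card_erase_of_mem ha_mem] at hcard
      omega)
    (by
      intro k _
      refine card_le_of_separated _ φ hL ?_ ?_
      · intro x hx
        have hxK := (Finset.mem_filter.1 (Finset.mem_filter.1 hx).1).1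
        obtain ⟨h1, h2, -⟩ := hK x hxK
        obtain ⟨m1, m2⟩ := hmem x hxK
        have b1 : (pos (r x.1) x.1.2 : ℝ) + 1 ≤ (S.path (r x.1)).length := by
          exact_mod_cast List.idxOf_lt_length_iff.2 m1
        have b2 : (pos (r x.2) x.1.2 : ℝ) + 1 ≤ (S.path (r x.2)).length := by
          exact_mod_cast List.idxOf_lt_length_iff.2 m2
        have c1 := hM _ (hrP _ h1)
        have c2 := hM _ (hrP _ h2)
        have d1 : (0 : ℝ) ≤ pos (r x.1) x.1.2 := Nat.cast_nonneg _
        have d2 : (0 : ℝ) ≤ pos (r x.2) x.1.2 := Nat.cast_nonneg _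
        simp only [φ]
        rw [abs_le]
        constructor <;> linarith
      · have key_lt : ∀ x ∈ (K.filter fun x => ¬ good x).filter fun x => key x = k,
            ∀ y ∈ (K.filter fun x => ¬ good x).filter fun x => key x = k,
            pos (r x.1) x.1.2 < pos (r x.1) y.1.2 → L < φ y - φ x := by
          intro x hx y hy hlt
          simp only [Finset.mem_filter] at hx hy
          by_contra! hle
          exact hx.1.2 ⟨y, hy.1.1, hy.2.trans hx.2.symm, hlt, hle⟩
        intro x hx y hy hne
        have hx' := hx
        have hy' := hy
        simp only [Finset.mem_filter] at hx' hy'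
        obtain ⟨k1, k2⟩ := Prod.ext_iff.1 (hx'.2.trans hy'.2.symm)
        simp only [key] at k1 k2
        rcases lt_trichotomy (pos (r x.1) x.1.2) (pos (r x.1) y.1.2) with hlt | heq | hlt
        · have := key_lt x hx y hy hlt
          rw [abs_sub_comm]
          exact this.trans_le (le_abs_self _)
        · exfalso
          have hv : x.1.2 = y.1.2 := (List.idxOf_inj (hmem x hx'.1.1).1).1 heq
          obtain ⟨hx1, hx2, -, hx3, -⟩ := hK x hx'.1.1
          obtain ⟨hy1, hy2, -, hy3, -⟩ := hK y hy'.1.1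
          apply hne
          refine Prod.ext ?_ ?_
          · exact eq_of_mem_pathEdges (S.nodup _ (hrP _ hx1)) (hr _ hx1) (k1 ▸ hr _ hy1) hv
          · exact eq_of_mem_pathEdges (S.nodup _ (hrP _ hx2)) (hr _ hx2) (k2 ▸ hr _ hy2)
              (hx3.trans (hv.trans hy3.symm))
        · have := key_lt y hy x hx (k1 ▸ hlt)
          exact this.trans_le (le_abs_self _))
    (by rw [Finset.card_product, ← sq]; exact h)
  -- each good partner of `e` yields its own nearby vertex
  choose! z hzK hzkey hzlt hzL using fun x (hx : good x) => hx
  set B := (K.filter good).filter fun x => x.1 = e with hB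
  have hBmem : ∀ x ∈ B, x ∈ K ∧ good x ∧ x.1 = e := by
    intro x hx
    simp only [hB, Finset.mem_filter] at hx
    exact ⟨hx.1.1, hx.1.2, hx.2⟩
  have hback : ∀ x ∈ B, pos (r x.2) (z x).1.2 < pos (r x.2) x.1.2 := by
    intro x hx
    obtain ⟨h1, h2, -⟩ := hBmem x hx
    exact hrev x h1 _ (hzK x h2) (hzkey x h2) (hzlt x h2)
  have hinj : Set.InjOn (fun x => (z x).1.2) (B : Set ((V × V) × (V × V))) := by
    intro x hx y hy hxy
    simp only at hxy
    obtain ⟨hxK, -, hxe⟩ := hBmem x hx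
    obtain ⟨hyK, -, hye⟩ := hBmem y hy
    obtain ⟨-, hx2, -, hx3, -⟩ := hK x hxK
    obtain ⟨-, hy2, -, hy3, -⟩ := hK y hyK
    have bx := hback x hx
    have b_y := hback y hy
    refine Prod.ext (hxe.trans hye.symm) ?_
    refine hS.edge_eq (hrP _ hx2) (hrP _ hy2) (hr _ hx2) (hr _ hy2) ?_ (x := (z x).1.2) ?_ ?_
    · rw [hx3, hy3, hxe, hye]
    · rw [hx3]
      exact bx
    · rw [hxy, hx3, hxe, ← hye]
      exact b_y
  have hcard : s + 1 ≤ (B.image fun x => (z x).1.2).card := by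
    rw [Finset.card_image_of_injOn hinj]
    exact he
  obtain ⟨T, hTsub, hT⟩ := Finset.exists_subset_card_eq hcard
  have hnear : ∀ u ∈ T, ∃ a b : ℕ, G.HasWalk a u e.2 ∧ G.HasWalk b e.2 u ∧ (a : ℝ) ≤ L ∧
      (b : ℝ) ≤ L := by
    intro u hu
    obtain ⟨x, hx, rfl⟩ := Finset.mem_image.1 (hTsub hu)
    obtain ⟨hxK, hxg, hxe⟩ := hBmem x hx
    obtain ⟨hx1, hx2, -⟩ := hK x hxK
    obtain ⟨m1, m2⟩ := hmem x hxK
    obtain ⟨m3, -⟩ := hmem _ (hzK x hxg)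
    obtain ⟨k1, k2⟩ := Prod.ext_iff.1 (hzkey x hxg)
    simp only [key] at k1 k2
    have l1 := hzlt x hxg
    have l2 := hback x hx
    have l3 := hzL x hxg
    simp only [φ] at l3
    rw [k1] at m3
    rw [k1, k2] at l3
    have w1 := (S.walk _ (hrP _ hx1)).hasWalk_idxOf m3 l1
    have w2 := (S.walk _ (hrP _ hx2)).hasWalk_idxOf m2 l2
    rw [← hxe]
    refine ⟨_, _, w2, w1, ?_, ?_⟩
    · change ((pos (r x.2) x.1.2 - pos (r x.2) (z x).1.2 : ℕ) : ℝ) ≤ L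
      rw [Nat.cast_sub l2.le]
      have : (pos (r x.1) x.1.2 : ℝ) < pos (r x.1) (z x).1.2 := by exact_mod_cast l1
      linarith
    · change ((pos (r x.1) (z x).1.2 - pos (r x.1) x.1.2 : ℕ) : ℝ) ≤ L
      rw [Nat.cast_sub l1.le]
      have : (pos (r x.2) (z x).1.2 : ℝ) < pos (r x.2) x.1.2 := by exact_mod_cast l2
      linarith
  refine ⟨T, hT, ?_, ?_⟩
  · intro v hv
    obtain ⟨x, hx, rfl⟩ := Finset.mem_image.1 (hTsub hv)
    have hzA := (hK _ (hzK x (hBmem x hx).2.1)).2.2.1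
    refine (Finset.mem_filter.1 hzA).2.trans_le (Finset.card_le_card ?_)
    intro f hf
    rw [Finset.mem_filter] at hf ⊢
    exact ⟨hf.1, Or.inr hf.2⟩
  · intro u hu v hv
    obtain ⟨a, -, wa, -, ha, -⟩ := hnear u hu
    obtain ⟨-, b, -, wb, -, hb⟩ := hnear v hv
    obtain ⟨hreach, hdist⟩ := hG.dist_le (wa.trans wb)
    refine ⟨hreach, hdist.trans ?_⟩
    push_cast
    linarith

/-- the Dense Low-Diameter Cluster Lemma. -/
theorem dense_low_diameter_cluster :
    ∃ c₀ c₁ c₂ c₃ : ℝ, 0 < c₀ ∧ 0 < c₁ ∧ 0 < c₂ ∧ 0 < c₃ ∧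
      ∀ (V : Type) [DecidableEq V] [Fintype V] (G : WDigraph V), G.Unweighted →
      ∀ (P : Finset (V × V)) (S : TBScheme G P), S.Consistent →
        (∀ e ∈ G.Edge, ∃ q ∈ P, e ∈ pathEdges (S.path q)) →
        ∀ n p d : ℕ, n = Fintype.card V → p = P.card → d = natCeilDiv G.Edge.card n →
        ∀ lhat : ℝ, lhat = (∑ q ∈ P, (((S.path q).length : ℝ) - 1)) / (p : ℝ) →
          (∀ q ∈ P, lhat / 2 ≤ ((S.path q).length : ℝ) - 1 ∧
            ((S.path q).length : ℝ) - 1 ≤ 2 * lhat) →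
          c₀ ≤ (d : ℝ) → 10 * (p : ℝ) / (n : ℝ) ^ ((1 : ℝ) / 2) ≤ (d : ℝ) →
          ∃ T : Finset V,
            c₁ * (d : ℝ) ≤ (T.card : ℝ) ∧ (T.card : ℝ) ≤ c₂ * (d : ℝ) ∧
            (∀ v ∈ T, c₁ * (d : ℝ) ≤ (G.degree v : ℝ)) ∧
            (∀ u ∈ T, ∀ v ∈ T, G.Reachable u v ∧
              G.dist u v ≤ c₃ * lhat * (p : ℝ) ^ 2 / ((n : ℝ) * (d : ℝ) ^ 2)) := by
  refine ⟨16, 1 / 16, 1, 256, by norm_num, by norm_num, by norm_num, by norm_num, ?_⟩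
  intro V _ _ G hG P S hS hcov n p d hn hp hd lhat _ hlen hd16 hdp
  have hd16' : 16 ≤ d := by exact_mod_cast hd16
  have hn0 : 0 < n := by
    rcases Nat.eq_zero_or_pos n with h0 | h0
    · rw [h0, natCeilDiv, Nat.div_zero] at hd
      omega
    · exact h0
  have hE : d * n ≤ G.Edge.card + n - 1 := by
    rw [hd]
    exact Nat.div_mul_le_self _ _
  have hEpos : 0 < G.Edge.card := by nlinarith [Nat.sub_le (G.Edge.card + n) 1]
  obtain ⟨e, he⟩ := Finset.card_pos.1 hEpos
  obtain ⟨q, hq, heq⟩ := hcov e he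
  have hp0 : 0 < p := hp ▸ Finset.card_pos.2 ⟨q, hq⟩
  have hl0 : 0 < lhat := by
    obtain ⟨i, hi, -⟩ := mem_pathEdges_iff.1 (show (e.1, e.2) ∈ pathEdges (S.path q) from heq)
    have h1 : (2 : ℝ) ≤ (S.path q).length := by exact_mod_cast (by omega : 2 ≤ _)
    linarith [(hlen q hq).2]
  have hnR : (0 : ℝ) < n := by exact_mod_cast hn0
  have hpR : (0 : ℝ) < p := by exact_mod_cast hp0
  have hdR : (0 : ℝ) < d := by linarith
  have hp2 : 100 * (p : ℝ) ^ 2 ≤ n * (d : ℝ) ^ 2 := by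
    rw [← Real.sqrt_eq_rpow, div_le_iff₀ (Real.sqrt_pos.2 hnR)] at hdp
    have h1 := pow_le_pow_left₀ (by positivity) hdp 2
    rw [mul_pow, mul_pow, Real.sq_sqrt hnR.le] at h1
    linarith
  set L : ℝ := 128 * lhat * (p : ℝ) ^ 2 / ((n : ℝ) * (d : ℝ) ^ 2) with hLdef
  have hL : 0 < L := by positivity
  obtain ⟨T, hTcard, hTdeg, hTdist⟩ := exists_cluster hG hS hcov hL (M := 2 * lhat)
    (fun q hq => (hlen q hq).2) (d / 4) (d / 16) (by
      have hheavy := card_le_card_heavy_add G.Edge (d / 4)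
      rw [← hn] at hheavy
      rw [← hp]
      generalize (G.Edge.filter fun e =>
        d / 4 < (G.Edge.filter fun f => f.2 = e.2).card).card = a at hheavy ⊢
      have ht1 : ((d / 4 : ℕ) : ℝ) ≤ d / 4 := by exact_mod_cast Nat.cast_div_le (α := ℝ)
      have ht2 : (d : ℝ) ≤ 4 * ((d / 4 : ℕ) : ℝ) + 3 := by exact_mod_cast (by omega)
      have hs1 : ((d / 16 : ℕ) : ℝ) ≤ d / 16 := by exact_mod_cast Nat.cast_div_le (α := ℝ)
      have hfloor : (⌊2 * (2 * lhat) / L⌋₊ : ℝ) * (p : ℝ) ^ 2 ≤ n * (d : ℝ) ^ 2 / 32 := by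
        calc (⌊2 * (2 * lhat) / L⌋₊ : ℝ) * (p : ℝ) ^ 2 ≤ 2 * (2 * lhat) / L * (p : ℝ) ^ 2 := by
              gcongr
              exact Nat.floor_le (by positivity)
          _ = n * (d : ℝ) ^ 2 / 32 := by
              rw [hLdef]
              field_simp
              norm_num
      have ha : (d : ℝ) * n ≤ a + ((d / 4 : ℕ) : ℝ) * n + n := by
        exact_mod_cast (by omega : d * n ≤ a + d / 4 * n + n)
      have ha' : (n : ℝ) * d / 2 ≤ a := by nlinarith
      have hts : (d : ℝ) / 8 ≤ ((d / 4 : ℕ) : ℝ) - ((d / 16 : ℕ) : ℝ) := by linarith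
      have hprod : (n : ℝ) * d / 2 * (d / 8) ≤ a * (((d / 4 : ℕ) : ℝ) - ((d / 16 : ℕ) : ℝ)) := by
        gcongr
      have hpos : 0 < (n : ℝ) * d ^ 2 := by positivity
      have hfinal : ((⌊2 * (2 * lhat) / L⌋₊ : ℝ) + 1) * p ^ 2 + a * ((d / 16 : ℕ) : ℝ)
          < a * ((d / 4 : ℕ) : ℝ) := by
        nlinarith
      exact_mod_cast hfinal)
  have hs : (d : ℝ) ≤ 16 * (((d / 16 : ℕ) : ℝ) + 1) := by exact_mod_cast (by omega)
  have hs' : ((d / 16 : ℕ) : ℝ) + 1 ≤ d := by exact_mod_cast (by omega)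
  refine ⟨T, ?_, ?_, ?_, ?_⟩
  · rw [hTcard]
    push_cast
    linarith
  · rw [hTcard]
    push_cast
    linarith
  · intro v hv
    have h1 := hTdeg v hv
    have h2 : (d : ℝ) ≤ 16 * G.degree v := by exact_mod_cast (by omega)
    linarith
  · intro u hu v hv
    obtain ⟨h1, h2⟩ := hTdist u hu v hv
    refine ⟨h1, h2.trans_eq ?_⟩
    rw [hLdef]
    ring
end

section
/- Let G be an n-vertex directed positively weighted graph that is the union of a collection Π of p directed paths, where each path in Π is the unique shortest path in G between its endpoints and the paths in Π are pairwise edge-disjoint. Then there exist a directed positively weighted graph G' with at most n vertices and a collection Π' of at most p directed paths such that: (i) G' is the union of the paths in Π'; (ii) each path in Π' is the unique shortest path in G' between its endpoints; (iii) the paths in Π' are pairwise edge-disjoint; (iv) every vertex of G' has total degree at least |E(G')|/(4n); (v) every path in Π' has at least |E(G')|/(4p) edges; and (vi) |E(G')| ≥ |E(G)|/2. -/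
open Finset

section PathEdges

variable {V : Type}

@[simp] theorem pathEdges_nil : pathEdges ([] : List V) = [] := rfl

@[simp] theorem pathEdges_singleton (a : V) : pathEdges [a] = [] := rfl

@[simp] theorem pathEdges_cons_cons (a b : V) (l : List V) :
    pathEdges (a :: b :: l) = (a, b) :: pathEdges (b :: l) := rfl

theorem length_pathEdges (l : List V) : (pathEdges l).length = l.length - 1 := by
  simp [pathEdges]

theorem nodup_pathEdges {l : List V} (h : l.Nodup) : (pathEdges l).Nodup := by
  apply List.Nodup.of_map Prod.snd
  rw [pathEdges, List.map_snd_zip (by simp)]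
  exact h.sublist (List.tail_sublist l)

theorem mem_pathEdges_iff_s15 {x y : V} {l : List V} :
    (x, y) ∈ pathEdges l ↔ ∃ A B, l = A ++ x :: y :: B := by
  constructor
  · induction l with
    | nil => simp
    | cons a l ih =>
      cases l with
      | nil => simp
      | cons b l =>
        rw [pathEdges_cons_cons, List.mem_cons]
        rintro (h | h)
        · obtain ⟨rfl, rfl⟩ := Prod.mk.inj h
          exact ⟨[], l, rfl⟩
        · obtain ⟨A, B, hAB⟩ := ih h
          exact ⟨a :: A, B, by rw [hAB]; rfl⟩
  · rintro ⟨A, B, rfl⟩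
    induction A with
    | nil => simp
    | cons a A ih =>
      cases A with
      | nil => simp
      | cons b A => exact List.mem_cons_of_mem _ ih

theorem isChain_iff_forall_mem_pathEdges {F : Finset (V × V)} {l : List V} :
    l.IsChain (fun a b => (a, b) ∈ F) ↔ ∀ e ∈ pathEdges l, e ∈ F := by
  induction l with
  | nil => simp
  | cons a l ih =>
    cases l with
    | nil => simp
    | cons b l => rw [List.isChain_cons_cons, ih]; simp

/-- Consecutive entries of `l.filter p` bound a segment of `l` whose interior avoids `p`. -/
theorem exists_segment_of_mem_pathEdges_filter {p : V → Bool} {x y : V} {l : List V}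
    (h : (x, y) ∈ pathEdges (l.filter p)) :
    ∃ A C B, l = A ++ (x :: C ++ [y]) ++ B ∧ C.filter p = [] ∧ p x ∧ p y := by
  obtain ⟨F₁, F₂, hF⟩ := mem_pathEdges_iff_s15.1 h
  obtain ⟨l₁, l₂, rfl, -, h₂⟩ := List.filter_eq_append_iff.1 hF
  obtain ⟨C₀, l₃, rfl, -, hx, h₃⟩ := List.filter_eq_cons_iff.1 h₂
  obtain ⟨C, l₄, rfl, hC, hy, -⟩ := List.filter_eq_cons_iff.1 h₃
  exact ⟨l₁ ++ C₀, C, l₄, by simp, by simpa using hC, hx, hy⟩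

/-- A list can be trimmed at both ends to the span of its entries satisfying `p`. -/
theorem exists_trim {p : V → Bool} {l : List V} (h : l.filter p ≠ []) :
    ∃ A M B, l = A ++ M ++ B ∧ M.filter p = l.filter p ∧
      M.head? = (l.filter p).head? ∧ M.getLast? = (l.filter p).getLast? := by
  obtain ⟨s, r, hs⟩ := List.exists_cons_of_ne_nil h
  obtain ⟨A, M₁, rfl, hA, hps, hr⟩ := List.filter_eq_cons_iff.1 hs
  have hA' : A.filter p = [] := by simpa using hA
  have hF : (A ++ s :: M₁).filter p = (s :: M₁).filter p := by simp [List.filter_append, hA']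
  rw [hF] at h hs ⊢
  have ht := List.dropLast_append_getLast h
  set t := ((s :: M₁).filter p).getLast h
  obtain ⟨l₁, l₂, hl, h₁, h₂⟩ := List.filter_eq_append_iff.1 ht.symm
  obtain ⟨C, D, rfl, hC, hpt, hD⟩ := List.filter_eq_cons_iff.1 h₂
  have hC' : C.filter p = [] := by simpa using hC
  have hlM : s :: M₁ = (l₁ ++ C ++ [t]) ++ D := by rw [hl]; simp
  have hfil : (l₁ ++ C ++ [t]).filter p = (s :: M₁).filter p := by
    conv_rhs => rw [← ht]
    rw [List.filter_append, List.filter_append, h₁, hC']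
    simp [hpt]
  refine ⟨A, l₁ ++ C ++ [t], D, by rw [hlM]; simp, hfil, ?_, ?_⟩
  · rw [hs]
    have := congrArg List.head? hlM
    rw [List.head?_append_of_ne_nil _ (by simp)] at this
    rw [← this]; rfl
  · conv_rhs => rw [← ht]
    simp

theorem card_biUnion_pathEdges [DecidableEq V] {ι : Type*} (Q : Finset ι) (g : ι → List V)
    (hnd : ∀ l ∈ Q, (g l).Nodup)
    (hdisj : ∀ l₁ ∈ Q, ∀ l₂ ∈ Q, l₁ ≠ l₂ → ∀ e ∈ pathEdges (g l₁), e ∉ pathEdges (g l₂)) :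
    (Q.biUnion fun l => (pathEdges (g l)).toFinset).card = ∑ l ∈ Q, ((g l).length - 1) := by
  rw [Finset.card_biUnion]
  · refine Finset.sum_congr rfl fun l hl => ?_
    rw [List.toFinset_card_of_nodup (nodup_pathEdges (hnd l hl)), length_pathEdges]
  · intro a ha b hb hab
    rw [Function.onFun, Finset.disjoint_left]
    simpa using fun x y h => hdisj a ha b hb hab (x, y) h

/-- Deleting a vertex from a path shortens it by at most the number of incident path edges. -/
theorem length_pred_le_erase [DecidableEq V] (f : List V) (v : V) :
    f.length - 1 ≤ ((f.erase v).length - 1) +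
      ((pathEdges f).toFinset.filter fun e => e.1 = v ∨ e.2 = v).card := by
  by_cases hv : v ∈ f
  swap
  · rw [List.erase_of_not_mem hv]; omega
  by_cases hlen : f.length ≤ 1
  · omega
  have hpos : 0 < ((pathEdges f).toFinset.filter fun e => e.1 = v ∨ e.2 = v).card := by
    rw [Finset.card_pos]
    obtain ⟨A, B, rfl⟩ := List.append_of_mem hv
    cases B with
    | cons b B =>
      exact ⟨(v, b), by simpa using mem_pathEdges_iff_s15.2 ⟨A, B, rfl⟩⟩
    | nil =>
      rcases List.eq_nil_or_concat A with rfl | ⟨A', a, rfl⟩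
      · simp at hlen
      · exact ⟨(a, v), by simpa using mem_pathEdges_iff_s15.2 ⟨A', [], by simp⟩⟩
  rw [List.length_erase_of_mem hv]
  omega

end PathEdges

namespace WDigraph

section Walks

variable {V : Type} {G : WDigraph V}

@[simp] theorem walkWeight_nil : G.walkWeight [] = 0 := rfl

@[simp] theorem walkWeight_singleton (a : V) : G.walkWeight [a] = 0 := rfl

@[simp] theorem walkWeight_cons_cons (a b : V) (l : List V) :
    G.walkWeight (a :: b :: l) = G.w (a, b) + G.walkWeight (b :: l) := by
  simp [walkWeight]

theorem walkWeight_append (A : List V) (x : V) (B : List V) :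
    G.walkWeight (A ++ x :: B) = G.walkWeight (A ++ [x]) + G.walkWeight (x :: B) := by
  induction A with
  | nil => simp
  | cons a A ih =>
    cases A with
    | nil => simp
    | cons b A =>
      simp only [List.cons_append, walkWeight_cons_cons] at ih ⊢
      rw [ih]; ring

theorem walkWeight_nonneg (hpos : G.PosWeights) {l : List V}
    (h : l.IsChain fun a b => (a, b) ∈ G.Edge) : 0 ≤ G.walkWeight l := by
  refine List.sum_nonneg fun x hx => ?_
  obtain ⟨e, he, rfl⟩ := List.mem_map.1 hx
  exact (hpos e (isChain_iff_forall_mem_pathEdges.1 h e he)).le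

/-- `l` is a walk, and every walk with the same endpoints and no larger weight equals `l`. -/
def IsUniqueShortest (G : WDigraph V) (l : List V) : Prop :=
  (l.IsChain fun a b => (a, b) ∈ G.Edge) ∧
    ∀ l' : List V, (l'.IsChain fun a b => (a, b) ∈ G.Edge) → l'.head? = l.head? →
      l'.getLast? = l.getLast? → G.walkWeight l' ≤ G.walkWeight l → l' = l

theorem IsUniqueShortest.le {l l' : List V} (h : G.IsUniqueShortest l)
    (hc : l'.IsChain fun a b => (a, b) ∈ G.Edge) (hh : l'.head? = l.head?)
    (ht : l'.getLast? = l.getLast?) : G.walkWeight l ≤ G.walkWeight l' := by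
  by_contra! hlt
  rw [h.2 l' hc hh ht hlt.le] at hlt
  exact lt_irrefl _ hlt

theorem IsUniqueShortest.isLeast {l : List V} {s t : V} (h : G.IsUniqueShortest l)
    (hs : l.head? = some s) (ht : l.getLast? = some t) :
    IsLeast {x | ∃ l, IsWalkOn G.Edge s t l ∧ G.walkWeight l = x} (G.walkWeight l) := by
  refine ⟨⟨l, ⟨h.1, hs, ht⟩, rfl⟩, ?_⟩
  rintro _ ⟨l', ⟨hc, hs', ht'⟩, rfl⟩
  exact h.le hc (hs'.trans hs.symm) (ht'.trans ht.symm)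

theorem IsUniqueShortest.dist_eq {l : List V} {s t : V} (h : G.IsUniqueShortest l)
    (hs : l.head? = some s) (ht : l.getLast? = some t) : G.dist s t = G.walkWeight l :=
  (h.isLeast hs ht).csInf_eq

theorem dist_le_walkWeight (hpos : G.PosWeights) {l : List V} {s t : V}
    (hw : G.IsWalk s t l) : G.dist s t ≤ G.walkWeight l := by
  refine csInf_le ⟨0, ?_⟩ ⟨l, hw, rfl⟩
  rintro _ ⟨l', hl', rfl⟩
  exact walkWeight_nonneg hpos hl'.1

theorem isUniqueShortest_of_dist (hpos : G.PosWeights) {l : List V} (hne : l ≠ [])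
    (hc : l.IsChain fun a b => (a, b) ∈ G.Edge)
    (h : ∀ s t : V, l.head? = some s → l.getLast? = some t →
      G.walkWeight l = G.dist s t ∧
      ∀ l', G.IsWalk s t l' → G.walkWeight l' = G.dist s t → l' = l) :
    G.IsUniqueShortest l := by
  refine ⟨hc, fun l' hc' hh ht hle => ?_⟩
  have h₁ := List.head?_eq_some_head hne
  have h₂ := List.getLast?_eq_some_getLast hne
  obtain ⟨hd, hu⟩ := h _ _ h₁ h₂
  have hw : G.IsWalk (l.head hne) (l.getLast hne) l' := ⟨hc', hh.trans h₁, ht.trans h₂⟩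
  exact hu l' hw (le_antisymm (hle.trans hd.le) (dist_le_walkWeight hpos hw))

theorem IsUniqueShortest.of_cons {a : V} {l : List V} (h : G.IsUniqueShortest (a :: l))
    (hne : l ≠ []) : G.IsUniqueShortest l := by
  obtain ⟨x, r, rfl⟩ := List.exists_cons_of_ne_nil hne
  obtain ⟨hax, hc⟩ := List.isChain_cons_cons.1 h.1
  refine ⟨hc, fun l' hc' hh ht hle => ?_⟩
  cases l' with
  | nil => simp at hh
  | cons y r' =>
    obtain rfl : y = x := by simpa using hh
    have := h.2 (a :: y :: r') (List.isChain_cons_cons.2 ⟨hax, hc'⟩) rfl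
      (by simpa [List.getLast?_cons_cons] using ht) (by simpa using hle)
    exact List.tail_eq_of_cons_eq this

theorem IsUniqueShortest.of_concat {l : List V} {b : V} (h : G.IsUniqueShortest (l ++ [b]))
    (hne : l ≠ []) : G.IsUniqueShortest l := by
  obtain ⟨r, x, rfl⟩ := (List.eq_nil_or_concat l).resolve_left hne
  rw [List.concat_eq_append] at *
  refine ⟨h.1.left_of_append, fun l' hc' hh ht hle => ?_⟩
  rcases List.eq_nil_or_concat l' with rfl | ⟨r', y, rfl⟩
  · simp at ht
  · rw [List.concat_eq_append] at *
    obtain rfl : y = x := by simpa using ht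
    have hy : (y, b) ∈ G.Edge := by
      have := isChain_iff_forall_mem_pathEdges.1 h.1 (y, b)
      exact this (mem_pathEdges_iff_s15.2 ⟨r, [], by simp⟩)
    have e : ∀ q : List V, q ++ [y] ++ [b] = q ++ y :: [b] := by simp
    have := h.2 (r' ++ [y] ++ [b])
      (hc'.append (List.isChain_singleton b) (by simpa using hy))
      (by simpa [List.head?_append] using congrArg (·.or (some b)) hh) (by simp)
      (by rw [e, e, walkWeight_append, walkWeight_append r]; linarith)
    exact List.append_cancel_right this

theorem IsUniqueShortest.of_append {A M B : List V} (h : G.IsUniqueShortest (A ++ M ++ B))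
    (hne : M ≠ []) : G.IsUniqueShortest M := by
  have h' : G.IsUniqueShortest (A ++ M) := by
    induction B using List.reverseRecOn with
    | nil => simpa using h
    | append_singleton B b ih =>
      rw [← List.append_assoc] at h
      exact ih (h.of_concat (by simp [hne]))
  clear h
  induction A with
  | nil => exact h'
  | cons a A ih => exact ih (h'.of_cons (by simp [hne]))

end Walks

section Contract

variable {V : Type} [DecidableEq V]

/-- The graph on `S` spanned by the traces on `S` of the paths in `Q`, weighted by the distances
of `G`. -/
noncomputable def contract (G : WDigraph V) (S : Finset V) (Q : Finset (List V)) : WDigraph V where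
  Edge := Q.biUnion fun l => (pathEdges (l.filter (· ∈ S))).toFinset
  w := fun e => G.dist e.1 e.2

variable {G : WDigraph V} {S : Finset V} {Q : Finset (List V)}

theorem isChain_contract {l : List V} (hl : l ∈ Q) :
    (l.filter (· ∈ S)).IsChain fun a b => (a, b) ∈ (G.contract S Q).Edge :=
  isChain_iff_forall_mem_pathEdges.2 fun _ he =>
    Finset.mem_biUnion.2 ⟨l, hl, List.mem_toFinset.2 he⟩

theorem exists_segment_of_mem_contract (hQ : ∀ l ∈ Q, G.IsUniqueShortest l) {x y : V}
    (h : (x, y) ∈ (G.contract S Q).Edge) :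
    ∃ C, C.filter (· ∈ S) = [] ∧ x ∈ S ∧ y ∈ S ∧ G.IsUniqueShortest (x :: C ++ [y]) := by
  obtain ⟨l, hl, he⟩ := Finset.mem_biUnion.1 h
  obtain ⟨A, C, B, rfl, hC, hx, hy⟩ := exists_segment_of_mem_pathEdges_filter (List.mem_toFinset.1 he)
  exact ⟨C, hC, by simpa using hx, by simpa using hy, (hQ _ hl).of_append (by simp)⟩

theorem posWeights_contract (hpos : G.PosWeights) (hQ : ∀ l ∈ Q, G.IsUniqueShortest l) :
    (G.contract S Q).PosWeights := by
  rintro ⟨x, y⟩ h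
  obtain ⟨C, -, -, -, hu⟩ := exists_segment_of_mem_contract hQ h
  change 0 < G.dist x y
  rw [hu.dist_eq (s := x) (t := y) rfl List.getLast?_concat]
  obtain ⟨z, r, hz⟩ := List.exists_cons_of_ne_nil (show C ++ [y] ≠ [] by simp)
  rw [List.cons_append, hz] at hu ⊢
  obtain ⟨hxz, hc⟩ := List.isChain_cons_cons.1 hu.1
  rw [walkWeight_cons_cons]
  exact add_pos_of_pos_of_nonneg (hpos _ hxz) (walkWeight_nonneg hpos hc)

/-- A walk of the contracted graph starting in `S` expands to a walk of `G` of equal weight. -/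
theorem exists_expansion (hQ : ∀ l ∈ Q, G.IsUniqueShortest l) {x : V} {r : List V} (hx : x ∈ S)
    (hc : (x :: r).IsChain fun a b => (a, b) ∈ (G.contract S Q).Edge) :
    ∃ R : List V, ((x :: R).IsChain fun a b => (a, b) ∈ G.Edge) ∧
      (x :: R).getLast? = (x :: r).getLast? ∧ (x :: R).filter (· ∈ S) = x :: r ∧
      G.walkWeight (x :: R) = (G.contract S Q).walkWeight (x :: r) := by
  induction r generalizing x with
  | nil => exact ⟨[], by simp, rfl, by simp [hx], rfl⟩
  | cons y r ih =>
    obtain ⟨hxy, hc⟩ := List.isChain_cons_cons.1 hc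
    obtain ⟨C, hC, -, hy, hu⟩ := exists_segment_of_mem_contract hQ hxy
    obtain ⟨R, hR, hlast, hfil, hw⟩ := ih hy hc
    refine ⟨C ++ y :: R, ?_, ?_, ?_, ?_⟩
    · rw [← List.cons_append, List.isChain_split]
      exact ⟨hu.1, hR⟩
    · rw [← List.cons_append, List.getLast?_append_of_ne_nil _ (by simp), hlast,
        List.getLast?_cons_cons]
    · rw [← List.cons_append, List.filter_append, hfil, List.filter_cons_of_pos (by simpa using hx),
        hC]
      rfl
    · rw [← List.cons_append, walkWeight_append, hw, walkWeight_cons_cons,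
        ← hu.dist_eq (s := x) (t := y) rfl List.getLast?_concat]
      rfl

theorem walkWeight_contract_filter_le (hpos : G.PosWeights) (M : List V)
    (hM : M.IsChain fun a b => (a, b) ∈ G.Edge) :
    (G.contract S Q).walkWeight (M.filter (· ∈ S)) ≤ G.walkWeight M := by
  match hf : M.filter (· ∈ S) with
  | [] => exact walkWeight_nonneg hpos hM
  | [x] => exact walkWeight_nonneg hpos hM
  | x :: y :: r =>
    obtain ⟨A, M', hMA, -, hx, hM'⟩ := List.filter_eq_cons_iff.1 hf
    obtain ⟨C, R, rfl, -, hy, hR⟩ := List.filter_eq_cons_iff.1 hM'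
    have hlt : (y :: R).length < M.length := by simp [hMA]; omega
    rw [hMA] at hM ⊢
    have hAx : (A ++ [x]).IsChain fun a b => (a, b) ∈ G.Edge := (List.isChain_split.1 hM).1
    have hxR := (List.isChain_split.1 hM).2
    rw [← List.cons_append] at hxR
    have hxy := (List.isChain_split.1 hxR).1
    have hyR := (List.isChain_split.1 hxR).2
    have ih := walkWeight_contract_filter_le hpos (y :: R) hyR
    rw [List.filter_cons_of_pos (p := (decide <| · ∈ S)) hy, hR] at ih
    have hd : G.dist x y ≤ G.walkWeight (x :: C ++ [y]) :=
      dist_le_walkWeight hpos ⟨hxy, rfl, List.getLast?_concat⟩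
    have hA := walkWeight_nonneg hpos hAx
    rw [walkWeight_cons_cons, walkWeight_append, ← List.cons_append, walkWeight_append (x :: C)]
    change G.dist x y + _ ≤ _
    linarith
termination_by M.length
decreasing_by exact hlt

theorem isUniqueShortest_contract (hpos : G.PosWeights) (hQ : ∀ l ∈ Q, G.IsUniqueShortest l)
    {l : List V} (hl : l ∈ Q) (hne : l.filter (· ∈ S) ≠ []) :
    (G.contract S Q).IsUniqueShortest (l.filter (· ∈ S)) := by
  refine ⟨isChain_contract hl, fun l' hc hh ht hle => ?_⟩
  obtain ⟨A, M, B, hlM, hfil, hhead, hlast⟩ := exists_trim hne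
  have hM : G.IsUniqueShortest M := by
    have := hQ l hl
    rw [hlM] at this
    refine this.of_append ?_
    rintro rfl
    exact hne (by rw [← hfil]; rfl)
  cases l' with
  | nil => exact absurd (List.head?_eq_none_iff.1 hh.symm) hne
  | cons x r =>
    have hx : x ∈ S := by
      have := List.mem_of_mem_head? (Option.mem_def.2 hh.symm)
      simpa using (List.mem_filter.1 this).2
    obtain ⟨R, hR, hRlast, hRfil, hRw⟩ := exists_expansion hQ hx hc
    have hfM := walkWeight_contract_filter_le (S := S) (Q := Q) hpos M hM.1
    rw [hfil] at hfM
    have := hM.2 (x :: R) hR (by rw [hhead, ← hh]; rfl) (by rw [hRlast, hlast, ht])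
      (by rw [hRw]; exact hle.trans hfM)
    rw [← hRfil, this, hfil]

theorem disjoint_pathEdges_filter (hQ : ∀ l ∈ Q, G.IsUniqueShortest l)
    (hdisj : ∀ l₁ ∈ Q, ∀ l₂ ∈ Q, l₁ ≠ l₂ → ∀ e ∈ pathEdges l₁, e ∉ pathEdges l₂) :
    ∀ l₁ ∈ Q, ∀ l₂ ∈ Q, l₁ ≠ l₂ →
      ∀ e ∈ pathEdges (l₁.filter (· ∈ S)), e ∉ pathEdges (l₂.filter (· ∈ S)) := by
  rintro l₁ h₁ l₂ h₂ hne ⟨x, y⟩ he₁ he₂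
  obtain ⟨A₁, C₁, B₁, rfl, -⟩ := exists_segment_of_mem_pathEdges_filter he₁
  obtain ⟨A₂, C₂, B₂, rfl, -⟩ := exists_segment_of_mem_pathEdges_filter he₂
  have hu₁ := (hQ _ h₁).of_append (M := x :: C₁ ++ [y]) (by simp)
  have hu₂ := (hQ _ h₂).of_append (M := x :: C₂ ++ [y]) (by simp)
  have hlast : (x :: C₁ ++ [y]).getLast? = (x :: C₂ ++ [y]).getLast? := by
    rw [List.getLast?_concat, List.getLast?_concat]
  have heq := hu₂.2 _ hu₁.1 rfl hlast (hu₁.le hu₂.1 rfl hlast.symm)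
  rw [heq] at hne h₁
  obtain ⟨z, r, hz⟩ := List.exists_cons_of_ne_nil (show C₂ ++ [y] ≠ [] by simp)
  refine hdisj _ h₁ _ h₂ hne (x, z) ?_ ?_ <;>
    rw [List.cons_append, hz] <;>
    exact mem_pathEdges_iff_s15.2 ⟨_, r ++ _, by simp; rfl⟩

theorem card_contract_edge (hQ : ∀ l ∈ Q, G.IsUniqueShortest l) (hnd : ∀ l ∈ Q, l.Nodup)
    (hdisj : ∀ l₁ ∈ Q, ∀ l₂ ∈ Q, l₁ ≠ l₂ → ∀ e ∈ pathEdges l₁, e ∉ pathEdges l₂) :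
    (G.contract S Q).Edge.card = ∑ l ∈ Q, ((l.filter (· ∈ S)).length - 1) :=
  card_biUnion_pathEdges Q _ (fun l hl => (hnd l hl).filter _)
    (disjoint_pathEdges_filter hQ hdisj)

/-- Deleting `v` from the vertex set loses at most `degree v` edges. -/
theorem card_contract_edge_le_erase (hQ : ∀ l ∈ Q, G.IsUniqueShortest l)
    (hnd : ∀ l ∈ Q, l.Nodup)
    (hdisj : ∀ l₁ ∈ Q, ∀ l₂ ∈ Q, l₁ ≠ l₂ → ∀ e ∈ pathEdges l₁, e ∉ pathEdges l₂) (v : V) :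
    (G.contract S Q).Edge.card ≤
      (G.contract (S.erase v) Q).Edge.card + (G.contract S Q).degree v := by
  have hdeg : (G.contract S Q).degree v = ∑ l ∈ Q,
      ((pathEdges (l.filter (· ∈ S))).toFinset.filter fun e => e.1 = v ∨ e.2 = v).card := by
    rw [degree, contract, Finset.filter_biUnion, Finset.card_biUnion]
    intro a ha b hb hab
    refine Finset.disjoint_filter_filter (Finset.disjoint_left.2 fun e h₁ h₂ => ?_)
    exact disjoint_pathEdges_filter hQ hdisj a ha b hb hab e (List.mem_toFinset.1 h₁)
      (List.mem_toFinset.1 h₂)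
  rw [hdeg, card_contract_edge hQ hnd hdisj, card_contract_edge hQ hnd hdisj,
    ← Finset.sum_add_distrib]
  refine Finset.sum_le_sum fun l hl => ?_
  have he : l.filter (· ∈ S.erase v) = (l.filter (· ∈ S)).erase v := by
    rw [((hnd l hl).filter _).erase_eq_filter, List.filter_filter]
    refine List.filter_congr fun a _ => ?_
    simp only [Finset.mem_erase, bne, ne_eq, Bool.decide_and, decide_not, beq_eq_decide]
  rw [he]
  exact length_pred_le_erase _ v

end Contract

end WDigraph

/-- the cleaning lemma — a union of `p` pairwise edge-disjoint unique
shortest paths can be replaced by one on at most `n` vertices where every vertex has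
degree at least `|E(G')|/(4n)`, every path has at least `|E(G')|/(4p)` edges, and at
least half of the edges survive. -/
theorem cleaning_lemma (V : Type) [DecidableEq V] [Fintype V] (n p : ℕ)
    (hn : Fintype.card V = n)
    (G : WDigraph V) (hpos : G.PosWeights)
    (Pcol : Finset (List V)) (hp : Pcol.card = p)
    (hpaths : ∀ l ∈ Pcol, l.Chain' (fun a b => (a, b) ∈ G.Edge) ∧ l ≠ [] ∧ l.Nodup)
    (hunion : G.Edge = Pcol.biUnion fun l => (pathEdges l).toFinset)
    (huniq : ∀ l ∈ Pcol, ∀ s t : V, l.head? = some s → l.getLast? = some t →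
      G.walkWeight l = G.dist s t ∧
      ∀ l', G.IsWalk s t l' → G.walkWeight l' = G.dist s t → l' = l)
    (hdisj : ∀ l₁ ∈ Pcol, ∀ l₂ ∈ Pcol, l₁ ≠ l₂ → ∀ e ∈ pathEdges l₁, e ∉ pathEdges l₂) :
    ∃ (G' : WDigraph V) (Pcol' : Finset (List V)),
      G'.PosWeights ∧ Pcol'.card ≤ p ∧
      -- at most `n` vertices
      (Pcol'.biUnion fun l => l.toFinset).card ≤ n ∧
      (∀ l ∈ Pcol', l.Chain' (fun a b => (a, b) ∈ G'.Edge) ∧ l ≠ [] ∧ l.Nodup) ∧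
      -- (i) `G'` is the union of the paths of `Pcol'`
      G'.Edge = (Pcol'.biUnion fun l => (pathEdges l).toFinset) ∧
      -- (ii) each path of `Pcol'` is the unique shortest path between its endpoints
      (∀ l ∈ Pcol', ∀ s t : V, l.head? = some s → l.getLast? = some t →
        G'.walkWeight l = G'.dist s t ∧
        ∀ l', G'.IsWalk s t l' → G'.walkWeight l' = G'.dist s t → l' = l) ∧
      -- (iii) pairwise edge-disjoint
      (∀ l₁ ∈ Pcol', ∀ l₂ ∈ Pcol', l₁ ≠ l₂ → ∀ e ∈ pathEdges l₁, e ∉ pathEdges l₂) ∧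
      -- (iv) minimum degree of the vertices of `G'`
      (∀ v : V, (∃ l ∈ Pcol', v ∈ l) →
        (G'.Edge.card : ℝ) / (4 * (n : ℝ)) ≤ (G'.degree v : ℝ)) ∧
      -- (v) every path is long
      (∀ l ∈ Pcol', (G'.Edge.card : ℝ) / (4 * (p : ℝ)) ≤ (l.length : ℝ) - 1) ∧
      -- (vi) at least half of the edges survive
      (G.Edge.card : ℝ) / 2 ≤ (G'.Edge.card : ℝ) := by
  have hQ₀ : ∀ l ∈ Pcol, G.IsUniqueShortest l := fun l hl =>
    WDigraph.isUniqueShortest_of_dist hpos (hpaths l hl).2.1 (hpaths l hl).1 (huniq l hl)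
  have hm₀ : G.Edge.card = ∑ l ∈ Pcol, (l.length - 1) := by
    rw [hunion]
    exact card_biUnion_pathEdges Pcol id (fun l hl => (hpaths l hl).2.2) hdisj
  rcases Nat.eq_zero_or_pos G.Edge.card with hzero | hmpos
  · exact ⟨⟨∅, fun _ => 0⟩, ∅, by simp [WDigraph.PosWeights], by simp, by simp, by simp, by simp,
      by simp, by simp, by simp, by simp, by simp [hzero]⟩
  have hppos : 0 < p := by
    rw [← hp, Finset.card_pos]
    by_contra! h
    simp [hm₀, h] at hmpos
  have hnpos : 0 < n := by
    obtain ⟨e, -⟩ := Finset.card_pos.1 hmpos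
    rw [← hn]
    exact Fintype.card_pos_iff.2 ⟨e.1⟩
  set m₀ : ℝ := (G.Edge.card : ℝ) with hm₀_def
  have hm₀pos : 0 < m₀ := Nat.cast_pos.2 hmpos
  have hnR : (0 : ℝ) < n := by exact_mod_cast hnpos
  have hpR : (0 : ℝ) < p := by exact_mod_cast hppos
  obtain ⟨⟨S, Q⟩, hSQ, hmax⟩ := Finset.exists_max_image
    ((Finset.univ : Finset V).powerset ×ˢ Pcol.powerset)
    (fun x => ((G.contract x.1 x.2).Edge.card : ℝ) - m₀ / (4 * n) * x.1.card
      - m₀ / (4 * p) * x.2.card) ⟨(∅, ∅), by simp⟩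
  simp only [Finset.mem_product, Finset.mem_powerset, Prod.forall] at hSQ hmax
  have hQP : Q ⊆ Pcol := hSQ.2
  have hQ : ∀ l ∈ Q, G.IsUniqueShortest l := fun l hl => hQ₀ l (hQP hl)
  have hnd : ∀ l ∈ Q, l.Nodup := fun l hl => (hpaths l (hQP hl)).2.2
  have hdQ : ∀ l₁ ∈ Q, ∀ l₂ ∈ Q, l₁ ≠ l₂ → ∀ e ∈ pathEdges l₁, e ∉ pathEdges l₂ :=
    fun a ha b hb => hdisj a (hQP ha) b (hQP hb)
  have hcard := WDigraph.card_contract_edge (S := S) hQ hnd hdQ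
  have hle : ((G.contract S Q).Edge.card : ℝ) ≤ m₀ := by
    rw [hm₀_def]
    norm_cast
    rw [hcard, hm₀]
    exact (Finset.sum_le_sum fun l _ => Nat.sub_le_sub_right (List.length_filter_le _ l) 1).trans
      (Finset.sum_le_sum_of_subset hQP)
  have hhalf : m₀ / 2 ≤ ((G.contract S Q).Edge.card : ℝ) := by
    have h := hmax Finset.univ Pcol ⟨subset_rfl, subset_rfl⟩
    have hfull : ((G.contract Finset.univ Pcol).Edge.card : ℝ) = m₀ := by
      rw [hm₀_def, WDigraph.card_contract_edge hQ₀ (fun l hl => (hpaths l hl).2.2) hdisj, hm₀]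
      simp
    rw [hfull, hp, Finset.card_univ, hn] at h
    have e₁ : m₀ / (4 * n) * n = m₀ / 4 := by field_simp
    have e₂ : m₀ / (4 * p) * p = m₀ / 4 := by field_simp
    have h₁ : 0 ≤ m₀ / (4 * n) * (S.card : ℝ) := by positivity
    have h₂ : 0 ≤ m₀ / (4 * p) * (Q.card : ℝ) := by positivity
    linarith
  have hdeg : ∀ v ∈ S, m₀ / (4 * n) ≤ ((G.contract S Q).degree v : ℝ) := by
    intro v hv
    have h := hmax (S.erase v) Q ⟨Finset.subset_univ _, hQP⟩
    have hd : ((G.contract S Q).Edge.card : ℝ) ≤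
        (G.contract (S.erase v) Q).Edge.card + (G.contract S Q).degree v := by
      exact_mod_cast WDigraph.card_contract_edge_le_erase hQ hnd hdQ v
    rw [← Finset.card_erase_add_one hv] at h
    push_cast at h
    linarith
  have hlen : ∀ l ∈ Q, m₀ / (4 * p) ≤ (((l.filter (· ∈ S)).length - 1 : ℕ) : ℝ) := by
    intro l hl
    have h := hmax S (Q.erase l) ⟨Finset.subset_univ _, (Finset.erase_subset _ _).trans hQP⟩
    have hsub : ∀ a ∈ Q.erase l, a ∈ Q := fun a ha => Finset.mem_of_mem_erase ha
    have hc : (G.contract S Q).Edge.card =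
        (G.contract S (Q.erase l)).Edge.card + ((l.filter (· ∈ S)).length - 1) := by
      rw [hcard, WDigraph.card_contract_edge (fun a ha => hQ a (hsub a ha))
        (fun a ha => hnd a (hsub a ha)) (fun a ha b hb => hdQ a (hsub a ha) b (hsub b hb)),
        Finset.sum_erase_add _ _ hl]
    rw [← Finset.card_erase_add_one hl, hc] at h
    push_cast at h ⊢
    linarith
  have hlong : ∀ l ∈ Q, 1 < (l.filter (· ∈ S)).length := by
    intro l hl
    have h : (0 : ℝ) < (((l.filter (· ∈ S)).length - 1 : ℕ) : ℝ) :=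
      lt_of_lt_of_le (by positivity) (hlen l hl)
    have : 0 < (l.filter (· ∈ S)).length - 1 := by exact_mod_cast h
    omega
  have hne : ∀ l ∈ Q, l.filter (· ∈ S) ≠ [] := fun l hl h => by
    have := hlong l hl
    simp [h] at this
  refine ⟨G.contract S Q, Q.image fun l => l.filter (· ∈ S),
    WDigraph.posWeights_contract hpos hQ, ?_, ?_, ?_, ?_, ?_, ?_, ?_, ?_, hhalf⟩
  · exact Finset.card_image_le.trans (hp ▸ Finset.card_le_card hQP)
  · exact hn ▸ Finset.card_le_univ _
  · rw [Finset.forall_mem_image]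
    exact fun l hl => ⟨WDigraph.isChain_contract hl, hne l hl, (hnd l hl).filter _⟩
  · rw [Finset.image_biUnion]
    rfl
  · rw [Finset.forall_mem_image]
    intro l hl s t hs ht
    have hu := WDigraph.isUniqueShortest_contract hpos hQ hl (hne l hl)
    have hd := hu.dist_eq hs ht
    exact ⟨hd.symm, fun l' hw he =>
      hu.2 l' hw.1 (hw.2.1.trans hs.symm) (hw.2.2.trans ht.symm) (he.trans hd).le⟩
  · simp only [Finset.forall_mem_image]
    intro a ha b hb hab
    exact WDigraph.disjoint_pathEdges_filter hQ hdQ a ha b hb fun h => hab (by rw [h])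
  · rintro v ⟨f, hf, hv⟩
    obtain ⟨l, hl, rfl⟩ := Finset.mem_image.1 hf
    have hvS : v ∈ S := by simpa using (List.mem_filter.1 hv).2
    exact (div_le_div_of_nonneg_right hle (by positivity)).trans (hdeg v hvS)
  · rw [Finset.forall_mem_image]
    intro l hl
    have h := hlen l hl
    rw [Nat.cast_sub (hlong l hl).le, Nat.cast_one] at h
    exact (div_le_div_of_nonneg_right hle (by positivity)).trans h
end
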